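/- arXiv:0904.1650 — 9 statements merged into one kernel-verified Lean document; each statement's English description precedes it below -/
import Mathlib

section
/- If S is an AG-groupoid with left identity, then every right ideal of S is a left ideal of S. -/
open Pointwise

/-- If `S` is an AG-groupoid with left identity, then every right ideal of `S`
is a left ideal of `S`. -/
theorem right_ideal_is_left_ideal {S : Type*} [Mul S]
    (hinv : ∀ a b c : S, (a * b) * c = (c * b) * a)
    (e : S) (he : ∀ a : S, e * a = a)
    (I : Set S) (hI : I * (Set.univ : Set S) ⊆ I) :
    (Set.univ : Set S) * I ⊆ I := by
  rintro _ ⟨s, -, i, hi, rfl⟩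
  have h : s * i = (i * s) * e := by rw [← hinv e s i, he]
  change s * i ∈ I
  rw [h]
  exact hI (Set.mul_mem_mul (hI (Set.mul_mem_mul hi (Set.mem_univ s))) (Set.mem_univ e))
end

section
/- If S is an AG-groupoid with left identity and I is a left ideal of S, then I² = II is a two-sided ideal of S (i.e., I²S ⊆ I² and SI² ⊆ I²). -/
open Pointwise

/-- If `S` is an AG-groupoid with left identity and `I` is a left ideal of `S`,
then `I² = I·I` is a two-sided ideal of `S`. -/
theorem sq_of_left_ideal_is_ideal {S : Type*} [Mul S]
    (hinv : ∀ a b c : S, (a * b) * c = (c * b) * a)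
    (e : S) (he : ∀ a : S, e * a = a)
    (I : Set S) (hI : (Set.univ : Set S) * I ⊆ I) :
    (I * I) * (Set.univ : Set S) ⊆ I * I ∧ (Set.univ : Set S) * (I * I) ⊆ I * I := by
  have hmem : ∀ s x : S, x ∈ I → s * x ∈ I := fun s x hx =>
    hI (Set.mul_mem_mul (Set.mem_univ s) hx)
  constructor
  · rintro _ ⟨_, ⟨a, ha, b, hb, rfl⟩, s, -, rfl⟩
    exact ⟨s * b, hmem s b hb, a, ha, hinv s b a⟩
  · rintro _ ⟨s, -, _, ⟨a, ha, b, hb, rfl⟩, rfl⟩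
    refine ⟨a, ha, s * b, hmem s b hb, ?_⟩
    calc a * (s * b) = (e * a) * (s * b) := by rw [he]
      _ = ((s * b) * a) * e := hinv _ _ _
      _ = ((a * b) * s) * e := by rw [hinv s b a]
      _ = (e * s) * (a * b) := hinv _ _ _
      _ = s * (a * b) := by rw [he]
end

section
/- Let S be an AG-groupoid with left identity, T a left ideal of S, and B a bi-ideal of S. Then BT is a bi-ideal of S. -/
open Pointwise

/-- The medial law: in an AG-groupoid the two middle factors may be exchanged. -/
theorem mul_mul_mul_comm_of_left_invertive {S : Type*} [Mul S]
    (hinv : ∀ a b c : S, (a * b) * c = (c * b) * a) (a b c d : S) :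
    (a * b) * (c * d) = (a * c) * (b * d) := by
  rw [hinv a b (c * d), hinv c d b, hinv (b * d) c a]

/-- Let `S` be an AG-groupoid with left identity, `T` a left ideal of `S`, and `B`
a bi-ideal of `S`. Then `B·T` is a bi-ideal of `S`. -/
theorem BT_is_bi_ideal {S : Type*} [Mul S]
    (hinv : ∀ a b c : S, (a * b) * c = (c * b) * a)
    (e : S) (he : ∀ a : S, e * a = a)
    (T : Set S) (hT : (Set.univ : Set S) * T ⊆ T)
    (B : Set S) (hB1 : B * B ⊆ B) (hB2 : (B * (Set.univ : Set S)) * B ⊆ B) :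
    (B * T) * (B * T) ⊆ B * T ∧ ((B * T) * (Set.univ : Set S)) * (B * T) ⊆ B * T := by
  have medial := mul_mul_mul_comm_of_left_invertive hinv
  have mul_mem_T (s : S) {t : S} (ht : t ∈ T) : s * t ∈ T :=
    hT (Set.mul_mem_mul (Set.mem_univ s) ht)
  constructor
  · rintro _ ⟨_, ⟨b, hb, t, -, rfl⟩, _, ⟨b', hb', t', ht', rfl⟩, rfl⟩
    change (b * t) * (b' * t') ∈ B * T
    rw [medial]
    exact Set.mul_mem_mul (hB1 (Set.mul_mem_mul hb hb')) (mul_mem_T t ht')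
  · rintro _ ⟨_, ⟨_, ⟨b, hb, t, -, rfl⟩, s, -, rfl⟩, _, ⟨b', hb', t', ht', rfl⟩, rfl⟩
    change ((b * t) * s) * (b' * t') ∈ B * T
    rw [← he s, medial b t e s, medial]
    exact Set.mul_mem_mul
      (hB2 (Set.mul_mem_mul (Set.mul_mem_mul hb (Set.mem_univ e)) hb')) (mul_mem_T _ ht')
end

section
/- Let S be an AG-groupoid with left identity, T a left ideal of S, and B a bi-ideal of S. Then T²B = (TT)B is a bi-ideal of S. -/
open Pointwise

/-- Let `S` be an AG-groupoid with left identity, `T` a left ideal of `S`, and `B`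
a bi-ideal of `S`. Then `T²·B = (T·T)·B` is a bi-ideal of `S`. -/
theorem T2B_is_bi_ideal {S : Type*} [Mul S]
    (hinv : ∀ a b c : S, (a * b) * c = (c * b) * a)
    (e : S) (he : ∀ a : S, e * a = a)
    (T : Set S) (hT : (Set.univ : Set S) * T ⊆ T)
    (B : Set S) (hB1 : B * B ⊆ B) (hB2 : (B * (Set.univ : Set S)) * B ⊆ B) :
    ((T * T) * B) * ((T * T) * B) ⊆ (T * T) * B ∧
      (((T * T) * B) * (Set.univ : Set S)) * ((T * T) * B) ⊆ (T * T) * B := by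
  have medial := mul_mul_mul_comm_of_left_invertive hinv
  have T_mul : ∀ s, ∀ t ∈ T, s * t ∈ T := fun s t ht =>
    hT (Set.mul_mem_mul (Set.mem_univ s) ht)
  constructor
  · rintro _ ⟨_, ⟨_, ⟨t₁, _, t₂, ht₂, rfl⟩, b, hb, rfl⟩, _,
      ⟨_, ⟨t₃, _, t₄, ht₄, rfl⟩, b', hb', rfl⟩, rfl⟩
    change ((t₁ * t₂) * b) * ((t₃ * t₄) * b') ∈ _
    rw [medial]
    exact Set.mul_mem_mul (Set.mul_mem_mul (T_mul _ _ ht₂) (T_mul _ _ ht₄))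
      (hB1 (Set.mul_mem_mul hb hb'))
  · rintro _ ⟨_, ⟨_, ⟨_, ⟨t₁, ht₁, t₂, _, rfl⟩, b, hb, rfl⟩, s, _, rfl⟩, _,
      ⟨_, ⟨t₃, _, t₄, ht₄, rfl⟩, b', hb', rfl⟩, rfl⟩
    change (((t₁ * t₂) * b) * s) * ((t₃ * t₄) * b') ∈ _
    have key : (((t₁ * t₂) * b) * s) * ((t₃ * t₄) * b') =
        ((t₂ * t₁) * (t₃ * t₄)) * ((b * s) * b') := by
      have h : ((t₁ * t₂) * b) * s = (t₂ * t₁) * (b * s) := by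
        rw [← he s, medial (t₁ * t₂) b e s, hinv t₁ t₂ e, he, he]
      rw [h, medial]
    rw [key]
    exact Set.mul_mem_mul (Set.mul_mem_mul (T_mul _ _ ht₁) (T_mul _ _ ht₄))
      (hB2 (Set.mul_mem_mul (Set.mul_mem_mul hb (Set.mem_univ s)) hb'))
end

section
/- If B₁ and B₂ are bi-ideals of an AG-groupoid S with left identity, then the product B₁B₂ is a bi-ideal of S. -/
open Pointwise

/-- If `B₁` and `B₂` are bi-ideals of an AG-groupoid `S` with left identity, then
the product `B₁·B₂` is a bi-ideal of `S`. -/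
theorem product_of_bi_ideals {S : Type*} [Mul S]
    (hinv : ∀ a b c : S, (a * b) * c = (c * b) * a)
    (e : S) (he : ∀ a : S, e * a = a)
    (B₁ : Set S) (hB₁1 : B₁ * B₁ ⊆ B₁) (hB₁2 : (B₁ * (Set.univ : Set S)) * B₁ ⊆ B₁)
    (B₂ : Set S) (hB₂1 : B₂ * B₂ ⊆ B₂) (hB₂2 : (B₂ * (Set.univ : Set S)) * B₂ ⊆ B₂) :
    (B₁ * B₂) * (B₁ * B₂) ⊆ B₁ * B₂ ∧
      ((B₁ * B₂) * (Set.univ : Set S)) * (B₁ * B₂) ⊆ B₁ * B₂ := by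
  have medial := mul_mul_mul_comm_of_left_invertive hinv
  constructor
  · rintro _ ⟨_, ⟨a, ha, b, hb, rfl⟩, _, ⟨c, hc, d, hd, rfl⟩, rfl⟩
    exact ⟨a * c, hB₁1 (Set.mul_mem_mul ha hc), b * d, hB₂1 (Set.mul_mem_mul hb hd),
      (medial a b c d).symm⟩
  · rintro _ ⟨_, ⟨_, ⟨a, ha, b, hb, rfl⟩, s, -, rfl⟩, _, ⟨c, hc, d, hd, rfl⟩, rfl⟩
    refine ⟨(a * e) * c, hB₁2 (Set.mul_mem_mul (Set.mul_mem_mul ha (Set.mem_univ e)) hc),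
      (b * s) * d, hB₂2 (Set.mul_mem_mul (Set.mul_mem_mul hb (Set.mem_univ s)) hd), ?_⟩
    change ((a * e) * c) * ((b * s) * d) = ((a * b) * s) * (c * d)
    rw [medial (a * e) c (b * s) d, medial a e b s, he]
end

section
/- If B is a bi-ideal of an AG-groupoid S with left identity e and e ∈ B, then B = S. Equivalently, if B is a proper bi-ideal of S (B ≠ S), then e ∉ B. -/
open Pointwise

/-- If `B` is a bi-ideal of an AG-groupoid `S` with left identity `e` and `e ∈ B`,
then `B = S`; equivalently, a proper bi-ideal does not contain `e`. -/
theorem bi_ideal_containing_left_identity {S : Type*} [Mul S]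
    (hinv : ∀ a b c : S, (a * b) * c = (c * b) * a)
    (e : S) (he : ∀ a : S, e * a = a)
    (B : Set S) (hB1 : B * B ⊆ B) (hB2 : (B * (Set.univ : Set S)) * B ⊆ B)
    (heB : e ∈ B) :
    B = (Set.univ : Set S) := by
  refine Set.eq_univ_of_forall fun s => ?_
  have h : (e * (s * e)) * e ∈ B :=
    hB2 (Set.mul_mem_mul (Set.mul_mem_mul heB (Set.mem_univ _)) heB)
  rwa [he, hinv, he, he] at h
end

section
/- Let S be an AG-groupoid with left identity. Then every bi-ideal of S is prime if and only if every bi-ideal of S is idempotent (B = BB) and the set of bi-ideals of S is totally ordered under inclusion (for any two bi-ideals I, J, either I ⊆ J or J ⊆ I). -/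
open Pointwise

/-- A bi-ideal of an AG-groupoid `S` is a subset `B` with `B·B ⊆ B` and
`(B·S)·B ⊆ B`. -/
def IsBiIdeal {S : Type*} [Mul S] (B : Set S) : Prop :=
  B * B ⊆ B ∧ (B * (Set.univ : Set S)) * B ⊆ B

/-- A bi-ideal `P` is prime if `B₁·B₂ ⊆ P` implies `B₁ ⊆ P` or `B₂ ⊆ P` for all
bi-ideals `B₁`, `B₂`. -/
def IsPrimeBiIdeal {S : Type*} [Mul S] (P : Set S) : Prop :=
  IsBiIdeal P ∧
    ∀ B₁ B₂ : Set S, IsBiIdeal B₁ → IsBiIdeal B₂ → B₁ * B₂ ⊆ P → B₁ ⊆ P ∨ B₂ ⊆ P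

theorem mul_left_comm_of_left_invertive {S : Type*} [Mul S]
    (hinv : ∀ a b c : S, (a * b) * c = (c * b) * a)
    (e : S) (he : ∀ a : S, e * a = a) (a b c : S) :
    a * (b * c) = b * (a * c) := by
  have h := mul_mul_mul_comm_of_left_invertive hinv e a b c
  rwa [he, he] at h

theorem mul_mul_mul_rev_of_left_invertive {S : Type*} [Mul S]
    (hinv : ∀ a b c : S, (a * b) * c = (c * b) * a)
    (e : S) (he : ∀ a : S, e * a = a) (a b c d : S) :
    (a * b) * (c * d) = (d * c) * (b * a) := by
  rw [mul_left_comm_of_left_invertive hinv e he (a * b) c d, hinv a b d,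
    mul_left_comm_of_left_invertive hinv e he c (d * b) a,
    mul_mul_mul_comm_of_left_invertive hinv d b c a]

theorem IsBiIdeal.mul {S : Type*} [Mul S]
    (hinv : ∀ a b c : S, (a * b) * c = (c * b) * a)
    (e : S) (he : ∀ a : S, e * a = a) {A B : Set S}
    (hA : IsBiIdeal A) (hB : IsBiIdeal B) : IsBiIdeal (A * B) := by
  have medial := mul_mul_mul_comm_of_left_invertive hinv
  constructor
  · rintro _ ⟨_, ⟨a, ha, b, hb, rfl⟩, _, ⟨c, hc, d, hd, rfl⟩, rfl⟩
    change a * b * (c * d) ∈ A * B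
    rw [medial]
    exact Set.mul_mem_mul (hA.1 (Set.mul_mem_mul ha hc)) (hB.1 (Set.mul_mem_mul hb hd))
  · rintro _ ⟨_, ⟨_, ⟨a, ha, b, hb, rfl⟩, s, -, rfl⟩, _, ⟨c, hc, d, hd, rfl⟩, rfl⟩
    change a * b * s * (c * d) ∈ A * B
    rw [← he s, medial a b e s, medial]
    exact Set.mul_mem_mul
      (hA.2 (Set.mul_mem_mul (Set.mul_mem_mul ha (Set.mem_univ e)) hc))
      (hB.2 (Set.mul_mem_mul (Set.mul_mem_mul hb (Set.mem_univ s)) hd))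

theorem IsBiIdeal.inter {S : Type*} [Mul S] {A B : Set S}
    (hA : IsBiIdeal A) (hB : IsBiIdeal B) : IsBiIdeal (A ∩ B) := by
  have hl : A ∩ B ⊆ A := Set.inter_subset_left
  have hr : A ∩ B ⊆ B := Set.inter_subset_right
  exact ⟨Set.subset_inter ((Set.mul_subset_mul hl hl).trans hA.1)
      ((Set.mul_subset_mul hr hr).trans hB.1),
    Set.subset_inter
      ((Set.mul_subset_mul (Set.mul_subset_mul_right hl) hl).trans hA.2)
      ((Set.mul_subset_mul (Set.mul_subset_mul_right hr) hr).trans hB.2)⟩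

theorem mul_mem_mul_univ_of_subset_mul_self {S : Type*} [Mul S]
    (hinv : ∀ a b c : S, (a * b) * c = (c * b) * a)
    (e : S) (he : ∀ a : S, e * a = a) {B : Set S} (hB : IsBiIdeal B) (hBB : B ⊆ B * B)
    (s : S) {b : S} (hb : b ∈ B) : s * b ∈ B * (Set.univ : Set S) := by
  obtain ⟨u, hu, v, hv, rfl⟩ := hBB hb
  change s * (u * v) ∈ _
  rw [← he s, mul_mul_mul_rev_of_left_invertive hinv e he]
  exact Set.mul_mem_mul (hB.1 (Set.mul_mem_mul hv hu)) (Set.mem_univ _)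

theorem IsBiIdeal.mul_mem_right {S : Type*} [Mul S]
    (hinv : ∀ a b c : S, (a * b) * c = (c * b) * a)
    (e : S) (he : ∀ a : S, e * a = a) {B : Set S} (hB : IsBiIdeal B) (hBB : B ⊆ B * B)
    {b : S} (hb : b ∈ B) (s : S) : b * s ∈ B := by
  obtain ⟨x, hx, y, hy, rfl⟩ := hBB hb
  change x * y * s ∈ B
  rw [hinv]
  exact hB.2 (Set.mul_mem_mul (mul_mem_mul_univ_of_subset_mul_self hinv e he hB hBB s hy) hx)

theorem IsBiIdeal.mul_mem_left {S : Type*} [Mul S]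
    (hinv : ∀ a b c : S, (a * b) * c = (c * b) * a)
    (e : S) (he : ∀ a : S, e * a = a) {B : Set S} (hB : IsBiIdeal B) (hBB : B ⊆ B * B)
    (s : S) {b : S} (hb : b ∈ B) : s * b ∈ B := by
  obtain ⟨c, hc, t, -, h⟩ := mul_mem_mul_univ_of_subset_mul_self hinv e he hB hBB s hb
  rw [← h]
  exact hB.mul_mem_right hinv e he hBB hc t

/-- Every bi-ideal of an AG-groupoid `S` with left identity is prime if and only if
every bi-ideal is idempotent and the set of bi-ideals of `S` is totally ordered
under inclusion. -/
theorem every_bi_ideal_prime_iff {S : Type*} [Mul S]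
    (hinv : ∀ a b c : S, (a * b) * c = (c * b) * a)
    (e : S) (he : ∀ a : S, e * a = a) :
    (∀ B : Set S, IsBiIdeal B → IsPrimeBiIdeal B) ↔
      ((∀ B : Set S, IsBiIdeal B → B = B * B) ∧
        ∀ I J : Set S, IsBiIdeal I → IsBiIdeal J → I ⊆ J ∨ J ⊆ I) := by
  constructor
  · intro hprime
    have hidem : ∀ B : Set S, IsBiIdeal B → B ⊆ B * B := fun B hB =>
      ((hprime _ (hB.mul hinv e he hB)).2 B B hB hB subset_rfl).elim id id
    refine ⟨fun B hB => (hidem B hB).antisymm hB.1, fun I J hI hJ => ?_⟩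
    have hIJ : I * J ⊆ I ∩ J := by
      rintro _ ⟨a, ha, b, hb, rfl⟩
      exact ⟨hI.mul_mem_right hinv e he (hidem I hI) ha b,
        hJ.mul_mem_left hinv e he (hidem J hJ) a hb⟩
    exact ((hprime _ (hI.inter hJ)).2 I J hI hJ hIJ).imp
      (fun h => h.trans Set.inter_subset_right) (fun h => h.trans Set.inter_subset_left)
  · rintro ⟨hidem, htotal⟩ P hP
    refine ⟨hP, fun I J hI hJ hIJ => (htotal I J hI hJ).imp (fun h => ?_) (fun h => ?_)⟩
    · rw [hidem I hI]
      exact (Set.mul_subset_mul_left h).trans hIJ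
    · rw [hidem J hJ]
      exact (Set.mul_subset_mul_right h).trans hIJ
end

section
/- If A and B are ideals of an anti-rectangular AG-groupoid S, then the product AB is an ideal of S (i.e., (AB)S ⊆ AB and S(AB) ⊆ AB). -/
open Pointwise

/-- In an anti-rectangular groupoid, a nonempty right ideal is everything. -/
theorem eq_univ_of_mul_univ_subset {S : Type*} [Mul S] (har : ∀ a b : S, (b * a) * b = a)
    {I : Set S} (hI : I * (Set.univ : Set S) ⊆ I) (hne : I.Nonempty) : I = Set.univ := by
  obtain ⟨b, hb⟩ := hne
  refine Set.eq_univ_of_forall fun x => ?_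
  have h : (b * x) * b ∈ I :=
    hI (Set.mul_mem_mul (hI (Set.mul_mem_mul hb (Set.mem_univ x))) (Set.mem_univ b))
  rwa [har] at h

/-- In an anti-rectangular groupoid, every element is a product. -/
theorem univ_mul_univ_eq_univ {S : Type*} [Mul S] (har : ∀ a b : S, (b * a) * b = a) :
    (Set.univ : Set S) * (Set.univ : Set S) = Set.univ :=
  Set.eq_univ_of_forall fun x => ⟨x * x, Set.mem_univ _, x, Set.mem_univ _, har x x⟩

/-- If `A` and `B` are ideals of an anti-rectangular AG-groupoid `S`
(`(b·a)·b = a` for all `a, b`), then `A·B` is an ideal of `S`. -/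
theorem product_of_ideals_anti_rectangular {S : Type*} [Mul S]
    (hinv : ∀ a b c : S, (a * b) * c = (c * b) * a)
    (har : ∀ a b : S, (b * a) * b = a)
    (A : Set S) (hA1 : A * (Set.univ : Set S) ⊆ A) (hA2 : (Set.univ : Set S) * A ⊆ A)
    (B : Set S) (hB1 : B * (Set.univ : Set S) ⊆ B) (hB2 : (Set.univ : Set S) * B ⊆ B) :
    (A * B) * (Set.univ : Set S) ⊆ A * B ∧ (Set.univ : Set S) * (A * B) ⊆ A * B := by
  rcases A.eq_empty_or_nonempty with rfl | hA
  · simp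
  rcases B.eq_empty_or_nonempty with rfl | hB
  · simp
  rw [eq_univ_of_mul_univ_subset har hA1 hA, eq_univ_of_mul_univ_subset har hB1 hB,
    univ_mul_univ_eq_univ har]
  exact ⟨Set.subset_univ _, Set.subset_univ _⟩
end

section
/- A subset I of an anti-rectangular AG-groupoid S is a left ideal of S if and only if it is a right ideal of S. -/
open Pointwise

/-- A subset `I` of an anti-rectangular AG-groupoid `S` (`(b·a)·b = a` for all
`a, b`) is a left ideal if and only if it is a right ideal. -/
theorem left_ideal_iff_right_ideal {S : Type*} [Mul S]
    (hinv : ∀ a b c : S, (a * b) * c = (c * b) * a)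
    (har : ∀ a b : S, (b * a) * b = a)
    (I : Set S) :
    (Set.univ : Set S) * I ⊆ I ↔ I * (Set.univ : Set S) ⊆ I := by
  simp only [Set.mul_subset_iff, Set.mem_univ, true_implies]
  constructor
  · intro h i hi s
    have key : i * s = (s * s) * (s * i) := by
      rw [← hinv (s * i) s s, har]
    rw [key]
    exact h _ _ (h _ _ hi)
  · intro h s i hi
    have key : s * i = (i * s) * (s * s) := by
      rw [← hinv (s * s) s i, har]
    rw [key]
    exact h _ (h _ hi _) _
end
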